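/- arXiv:2303.03782 — 3 statements merged into one kernel-verified Lean document; each statement's English description precedes it below -/
import Mathlib

section
/- Let θ > 0 and α ∈ (−θ, 1). For all measurable f₁, f₂ : [1,∞) → [0,1] with ‖f₁‖_α < ∞ and ‖f₂‖_α < ∞, one has ‖T(f₁) − T(f₂)‖_α ≤ c(α,θ) ‖f₁ − f₂‖_α, where c(α,θ) = Γ(1−α)Γ(α+θ)/Γ(θ); i.e., T : F_α → F_α is Lipschitz with constant c(α,θ). -/
open MeasureTheory Real Set

/-- The operator `T` from the integral equation for crossing probabilities. -/
noncomputable def T (θ : ℝ) (f : ℝ → ℝ) : ℝ → ℝ :=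
  fun s => 1 - (1 - 1 / s) ^ θ +
    θ * (s - 1) ^ θ * ∫ t in Ioi (1 : ℝ), (s + t - 1) ^ (-θ - 1) * f t

/-- The norm `‖f‖_α = sup_{s ≥ 1} s^α |f s|` of the space `F_α`. -/
noncomputable def normF (α : ℝ) (f : ℝ → ℝ) : ℝ :=
  sSup ((fun s => s ^ α * |f s|) '' Ici 1)

lemma lintegral_rpow_mul_exp_neg_mul {p r : ℝ} (hp : 0 < p) (hr : 0 < r) :
    ∫⁻ t in Ioi (0 : ℝ), ENNReal.ofReal (t ^ (p - 1) * exp (-(r * t))) =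
      ENNReal.ofReal (r ^ (-p) * Real.Gamma p) := by
  have hint : IntegrableOn (fun t : ℝ => t ^ (p - 1) * exp (-(r * t))) (Ioi 0) := by
    simpa using integrableOn_rpow_mul_exp_neg_mul_rpow (p := 1) (s := p - 1) (b := r)
      (by linarith) (by norm_num) hr
  rw [← ofReal_integral_eq_lintegral_ofReal hint, integral_rpow_mul_exp_neg_mul_Ioi hp hr,
    one_div, inv_rpow hr.le, rpow_neg hr.le]
  filter_upwards [ae_restrict_mem measurableSet_Ioi] with t ht
  have : (0 : ℝ) < t := ht
  positivity

/-- The beta integral of the second kind, in `ℝ≥0∞` form. -/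
lemma lintegral_add_rpow_mul_rpow {a p q : ℝ} (ha : 0 < a) (hp : 0 < p) (hq : 0 < q) :
    ∫⁻ u in Ioi (0 : ℝ), ENNReal.ofReal ((a + u) ^ (-(p + q)) * u ^ (p - 1)) =
      ENNReal.ofReal (a ^ (-q) * (Real.Gamma p * Real.Gamma q / Real.Gamma (p + q))) := by
  have hG : 0 < Real.Gamma (p + q) := Gamma_pos_of_pos (by linarith)
  have hGp := Gamma_pos_of_pos hp
  have hGq := Gamma_pos_of_pos hq
  have key : ∫⁻ u in Ioi (0 : ℝ),
      ENNReal.ofReal (Real.Gamma (p + q) * ((a + u) ^ (-(p + q)) * u ^ (p - 1))) =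
      ENNReal.ofReal (Real.Gamma p * (a ^ (-q) * Real.Gamma q)) := by
    calc
      _ = ∫⁻ u in Ioi (0 : ℝ), ∫⁻ x in Ioi (0 : ℝ), ENNReal.ofReal
            (u ^ (p - 1) * (x ^ (p + q - 1) * exp (-((a + u) * x)))) := by
        refine setLIntegral_congr_fun measurableSet_Ioi fun u hu => ?_
        have hu : (0 : ℝ) < u := hu
        have hu' : 0 ≤ u ^ (p - 1) := by positivity
        simp only [ENNReal.ofReal_mul hu']
        rw [lintegral_const_mul _ (by fun_prop),
          lintegral_rpow_mul_exp_neg_mul (by linarith) (by linarith), ← ENNReal.ofReal_mul hu']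
        congr 1
        ring
      _ = ∫⁻ x in Ioi (0 : ℝ), ∫⁻ u in Ioi (0 : ℝ), ENNReal.ofReal
            (u ^ (p - 1) * (x ^ (p + q - 1) * exp (-((a + u) * x)))) :=
        lintegral_lintegral_swap (by fun_prop)
      _ = ∫⁻ x in Ioi (0 : ℝ),
            ENNReal.ofReal (Real.Gamma p * (x ^ (q - 1) * exp (-(a * x)))) := by
        refine setLIntegral_congr_fun measurableSet_Ioi fun x hx => ?_
        have hx : (0 : ℝ) < x := hx
        have hc : 0 ≤ x ^ (p + q - 1) * exp (-(a * x)) := by positivity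
        have hsplit (u : ℝ) : u ^ (p - 1) * (x ^ (p + q - 1) * exp (-((a + u) * x))) =
            (x ^ (p + q - 1) * exp (-(a * x))) * (u ^ (p - 1) * exp (-(x * u))) := by
          rw [show -((a + u) * x) = -(a * x) + -(x * u) by ring, exp_add]
          ring
        simp only [hsplit, ENNReal.ofReal_mul hc]
        rw [lintegral_const_mul _ (by fun_prop), lintegral_rpow_mul_exp_neg_mul hp hx,
          ← ENNReal.ofReal_mul hc]
        congr 1
        rw [show q - 1 = (p + q - 1) + -p by ring, rpow_add hx]
        ring
      _ = _ := by
        simp only [ENNReal.ofReal_mul hGp.le]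
        rw [lintegral_const_mul _ (by fun_prop), lintegral_rpow_mul_exp_neg_mul hq ha]
  simp only [ENNReal.ofReal_mul hG.le] at key
  rw [lintegral_const_mul _ (by fun_prop)] at key
  have h0 : ENNReal.ofReal (Real.Gamma (p + q)) ≠ 0 := by simpa using hG
  rw [← ENNReal.mul_right_inj h0 ENNReal.ofReal_ne_top, key, ← ENNReal.ofReal_mul hG.le]
  congr 1
  field_simp

lemma integrableOn_add_rpow_mul_rpow {a p q : ℝ} (ha : 0 < a) (hp : 0 < p) (hq : 0 < q) :
    IntegrableOn (fun u : ℝ => (a + u) ^ (-(p + q)) * u ^ (p - 1)) (Ioi 0) := by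
  refine ⟨(by fun_prop : Measurable _).aestronglyMeasurable, ?_⟩
  rw [hasFiniteIntegral_iff_ofReal, lintegral_add_rpow_mul_rpow ha hp hq]
  · exact ENNReal.ofReal_lt_top
  · filter_upwards [ae_restrict_mem measurableSet_Ioi] with u hu
    have : (0 : ℝ) < u := hu
    positivity

lemma integral_add_rpow_mul_rpow {a p q : ℝ} (ha : 0 < a) (hp : 0 < p) (hq : 0 < q) :
    ∫ u in Ioi (0 : ℝ), (a + u) ^ (-(p + q)) * u ^ (p - 1) =
      a ^ (-q) * (Real.Gamma p * Real.Gamma q / Real.Gamma (p + q)) := by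
  have hG : 0 < Real.Gamma (p + q) := Gamma_pos_of_pos (by linarith)
  have hGp := Gamma_pos_of_pos hp
  have hGq := Gamma_pos_of_pos hq
  rw [integral_eq_lintegral_of_nonneg_ae, lintegral_add_rpow_mul_rpow ha hp hq,
    ENNReal.toReal_ofReal (by positivity)]
  · filter_upwards [ae_restrict_mem measurableSet_Ioi] with u hu
    have : (0 : ℝ) < u := hu
    simp only [Pi.zero_apply]
    positivity
  · exact (by fun_prop : Measurable _).aestronglyMeasurable

/-- The kernel of `T` against the weight `t ^ (-α)`, for `α ≤ 0`: the domain of integration is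
enlarged to `(0, ∞)`. -/
lemma kernel_bound_of_nonpos {θ α s : ℝ} (hαθ : -θ < α) (hα : α ≤ 0) (hs : 1 < s) :
    IntegrableOn (fun t : ℝ => (s + t - 1) ^ (-θ - 1) * t ^ (-α)) (Ioi 1) ∧
    ∫ t in Ioi (1 : ℝ), (s + t - 1) ^ (-θ - 1) * t ^ (-α) ≤
      (s - 1) ^ (-(θ + α)) *
        (Real.Gamma (1 - α) * Real.Gamma (α + θ) / Real.Gamma (θ + 1)) := by
  have ha : 0 < s - 1 := by linarith
  have hp : 0 < 1 - α := by linarith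
  have hq : 0 < θ + α := by linarith
  have heq : (fun t : ℝ => (s + t - 1) ^ (-θ - 1) * t ^ (-α)) =
      fun t => (s - 1 + t) ^ (-((1 - α) + (θ + α))) * t ^ ((1 - α) - 1) := by
    ext t
    congr 2 <;> ring
  have hint := integrableOn_add_rpow_mul_rpow ha hp hq
  have hsub : Ioi (1 : ℝ) ⊆ Ioi 0 := Ioi_subset_Ioi zero_le_one
  rw [heq]
  refine ⟨hint.mono_set hsub, (setIntegral_mono_set hint ?_ hsub.eventuallyLE).trans_eq ?_⟩
  · filter_upwards [ae_restrict_mem measurableSet_Ioi] with u hu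
    have : (0 : ℝ) < u := hu
    simp only [Pi.zero_apply]
    positivity
  · rw [integral_add_rpow_mul_rpow ha hp hq]
    rw [show 1 - α + (θ + α) = θ + 1 by ring, add_comm θ α]

/-- The kernel of `T` against the weight `t ^ (-α)`, for `0 ≤ α`: the weight is replaced by the
larger `(t - 1) ^ (-α)`. -/
lemma kernel_bound_of_nonneg {θ α s : ℝ} (hθ : 0 < θ) (hα : 0 ≤ α) (hα1 : α < 1) (hs : 1 < s) :
    IntegrableOn (fun t : ℝ => (s + t - 1) ^ (-θ - 1) * t ^ (-α)) (Ioi 1) ∧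
    ∫ t in Ioi (1 : ℝ), (s + t - 1) ^ (-θ - 1) * t ^ (-α) ≤
      s ^ (-(θ + α)) *
        (Real.Gamma (1 - α) * Real.Gamma (α + θ) / Real.Gamma (θ + 1)) := by
  have ha : 0 < s := by linarith
  have hp : 0 < 1 - α := by linarith
  have hq : 0 < θ + α := by linarith
  let g : ℝ → ℝ := fun u => (s + u) ^ (-((1 - α) + (θ + α))) * u ^ ((1 - α) - 1)
  have hint : IntegrableOn g (Ioi 0) := integrableOn_add_rpow_mul_rpow ha hp hq
  have hpre : (fun t : ℝ => t - 1) ⁻¹' Ioi 0 = Ioi 1 := by simp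
  have hmp := measurePreserving_sub_right (volume : Measure ℝ) 1
  have hemb := measurableEmbedding_subRight (1 : ℝ)
  have hshift : IntegrableOn (fun t => g (t - 1)) (Ioi 1) := by
    have := (hmp.integrableOn_comp_preimage hemb).2 hint
    rwa [hpre] at this
  have hval : ∫ t in Ioi (1 : ℝ), g (t - 1) = ∫ u in Ioi (0 : ℝ), g u := by
    rw [← hmp.setIntegral_preimage_emb hemb g, hpre]
  have hle : ∀ t ∈ Ioi (1 : ℝ), (s + t - 1) ^ (-θ - 1) * t ^ (-α) ≤ g (t - 1) := by
    intro t ht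
    have ht : (1 : ℝ) < t := ht
    have h1 : t ^ (-α) ≤ (t - 1) ^ (-α) :=
      rpow_le_rpow_of_nonpos (by linarith) (by linarith) (by linarith)
    have h2 : g (t - 1) = (s + t - 1) ^ (-θ - 1) * (t - 1) ^ (-α) := by
      simp only [g]
      congr 2 <;> ring
    rw [h2]
    have h3 : 0 < s + t - 1 := by linarith
    gcongr
  have hint' : IntegrableOn (fun t : ℝ => (s + t - 1) ^ (-θ - 1) * t ^ (-α)) (Ioi 1) := by
    refine Integrable.mono' hshift (by fun_prop : Measurable _).aestronglyMeasurable ?_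
    filter_upwards [ae_restrict_mem measurableSet_Ioi] with t ht
    have ht' : (1 : ℝ) < t := ht
    have h3 : 0 < s + t - 1 := by linarith
    have h4 : 0 < t := by linarith
    rw [norm_of_nonneg (by positivity)]
    exact hle t ht
  refine ⟨hint', (setIntegral_mono_on hint' hshift measurableSet_Ioi hle).trans_eq ?_⟩
  rw [hval, integral_add_rpow_mul_rpow ha hp hq]
  rw [show 1 - α + (θ + α) = θ + 1 by ring, add_comm θ α]

lemma integrableOn_kernel {θ α s : ℝ} (hθ : 0 < θ) (hα : α ∈ Ioo (-θ) 1) (hs : 1 < s) :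
    IntegrableOn (fun t : ℝ => (s + t - 1) ^ (-θ - 1) * t ^ (-α)) (Ioi 1) := by
  rcases le_total α 0 with h | h
  · exact (kernel_bound_of_nonpos hα.1 h hs).1
  · exact (kernel_bound_of_nonneg hθ h hα.2 hs).1

lemma kernel_bound {θ α s : ℝ} (hθ : 0 < θ) (hα : α ∈ Ioo (-θ) 1) (hs : 1 < s) :
    s ^ α * (θ * (s - 1) ^ θ * ∫ t in Ioi (1 : ℝ), (s + t - 1) ^ (-θ - 1) * t ^ (-α)) ≤
      Real.Gamma (1 - α) * Real.Gamma (α + θ) / Real.Gamma θ := by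
  obtain ⟨hα0, hα1⟩ := hα
  have hs0 : 0 < s := by linarith
  have ha : 0 < s - 1 := by linarith
  have hG1 : 0 < Real.Gamma (1 - α) := Gamma_pos_of_pos (by linarith)
  have hG2 : 0 < Real.Gamma (α + θ) := Gamma_pos_of_pos (by linarith)
  have hG : 0 < Real.Gamma θ := Gamma_pos_of_pos hθ
  have hB : θ * (Real.Gamma (1 - α) * Real.Gamma (α + θ) / Real.Gamma (θ + 1)) =
      Real.Gamma (1 - α) * Real.Gamma (α + θ) / Real.Gamma θ := by
    rw [Gamma_add_one hθ.ne']
    field_simp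
  have hc : 0 ≤ Real.Gamma (1 - α) * Real.Gamma (α + θ) / Real.Gamma θ := by positivity
  suffices ∃ w, w ^ (-(θ + α)) * (s ^ α * (s - 1) ^ θ) ≤ 1 ∧
      ∫ t in Ioi (1 : ℝ), (s + t - 1) ^ (-θ - 1) * t ^ (-α) ≤ w ^ (-(θ + α)) *
        (Real.Gamma (1 - α) * Real.Gamma (α + θ) / Real.Gamma (θ + 1)) by
    obtain ⟨w, hw, hI⟩ := this
    calc
      _ ≤ s ^ α * (θ * (s - 1) ^ θ * (w ^ (-(θ + α)) *
          (Real.Gamma (1 - α) * Real.Gamma (α + θ) / Real.Gamma (θ + 1)))) := by gcongr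
      _ = (w ^ (-(θ + α)) * (s ^ α * (s - 1) ^ θ)) *
          (θ * (Real.Gamma (1 - α) * Real.Gamma (α + θ) / Real.Gamma (θ + 1))) := by ring
      _ ≤ _ := by
        rw [hB]
        exact mul_le_of_le_one_left hc hw
  rcases le_total α 0 with h | h
  · refine ⟨s - 1, ?_, (kernel_bound_of_nonpos hα0 h hs).2⟩
    have h1 : s ^ α ≤ (s - 1) ^ α := rpow_le_rpow_of_nonpos ha (by linarith) h
    calc
      _ ≤ (s - 1) ^ (-(θ + α)) * ((s - 1) ^ α * (s - 1) ^ θ) := by gcongr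
      _ = 1 := by
        rw [← rpow_add ha, ← rpow_add ha, show -(θ + α) + (α + θ) = 0 by ring, rpow_zero]
  · refine ⟨s, ?_, (kernel_bound_of_nonneg hθ h hα1 hs).2⟩
    have h1 : (s - 1) ^ θ ≤ s ^ θ := by gcongr; linarith
    calc
      _ ≤ s ^ (-(θ + α)) * (s ^ α * s ^ θ) := by gcongr
      _ = 1 := by
        rw [← rpow_add hs0, ← rpow_add hs0, show -(θ + α) + (α + θ) = 0 by ring, rpow_zero]

lemma integrableOn_kernel_mul {θ s : ℝ} {f : ℝ → ℝ} (hθ : 0 < θ) (hs : 1 < s)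
    (hf : Measurable f) (hf' : ∀ t, 1 ≤ t → f t ∈ Icc (0 : ℝ) 1) :
    IntegrableOn (fun t : ℝ => (s + t - 1) ^ (-θ - 1) * f t) (Ioi 1) := by
  refine Integrable.mono' (integrableOn_kernel (α := 0) hθ ⟨by linarith, one_pos⟩ hs)
    (by fun_prop : Measurable _).aestronglyMeasurable ?_
  filter_upwards [ae_restrict_mem measurableSet_Ioi] with t ht
  have ht : (1 : ℝ) < t := ht
  have h3 : 0 < s + t - 1 := by linarith
  have hft := hf' t ht.le
  have := hft.1
  rw [norm_of_nonneg (by positivity), neg_zero, rpow_zero]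
  gcongr
  exact hft.2

lemma normF_nonneg (α : ℝ) (f : ℝ → ℝ) : 0 ≤ normF α f := by
  refine Real.sSup_nonneg ?_
  rintro _ ⟨s, hs, rfl⟩
  have : (0 : ℝ) < s := zero_lt_one.trans_le hs
  positivity

lemma abs_le_normF_mul_rpow {α t : ℝ} {f : ℝ → ℝ}
    (hf : BddAbove ((fun s => s ^ α * |f s|) '' Ici 1)) (ht : 1 ≤ t) :
    |f t| ≤ normF α f * t ^ (-α) := by
  have ht0 : 0 < t := by linarith
  have h : t ^ α * |f t| ≤ normF α f := le_csSup hf ⟨t, ht, rfl⟩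
  rw [rpow_neg ht0.le, ← div_eq_mul_inv, le_div_iff₀ (by positivity)]
  linarith

lemma bddAbove_weighted_sub {α : ℝ} {f₁ f₂ : ℝ → ℝ}
    (h₁ : BddAbove ((fun s => s ^ α * |f₁ s|) '' Ici 1))
    (h₂ : BddAbove ((fun s => s ^ α * |f₂ s|) '' Ici 1)) :
    BddAbove ((fun s => s ^ α * |f₁ s - f₂ s|) '' Ici 1) := by
  obtain ⟨M₁, hM₁⟩ := h₁
  obtain ⟨M₂, hM₂⟩ := h₂
  refine ⟨M₁ + M₂, ?_⟩
  rintro _ ⟨s, hs, rfl⟩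
  have hs0 : (0 : ℝ) < s := zero_lt_one.trans_le hs
  calc
    s ^ α * |f₁ s - f₂ s| ≤ s ^ α * (|f₁ s| + |f₂ s|) := by
      gcongr
      exact abs_sub _ _
    _ = s ^ α * |f₁ s| + s ^ α * |f₂ s| := mul_add _ _ _
    _ ≤ M₁ + M₂ := add_le_add (hM₁ ⟨s, hs, rfl⟩) (hM₂ ⟨s, hs, rfl⟩)

/-- For `θ > 0` and `α ∈ (−θ, 1)`, the map `T : F_α → F_α` is
Lipschitz with constant `c(α,θ) = Γ(1−α)Γ(α+θ)/Γ(θ)`: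
`‖T f₁ − T f₂‖_α ≤ c(α,θ) ‖f₁ − f₂‖_α`. -/
theorem T_lipschitz (θ α : ℝ) (hθ : 0 < θ) (hα : α ∈ Ioo (-θ) 1)
    (f₁ f₂ : ℝ → ℝ) (hf₁_meas : Measurable f₁) (hf₂_meas : Measurable f₂)
    (hf₁_mem : ∀ s, 1 ≤ s → f₁ s ∈ Icc (0 : ℝ) 1)
    (hf₂_mem : ∀ s, 1 ≤ s → f₂ s ∈ Icc (0 : ℝ) 1)
    (hf₁_norm : BddAbove ((fun s => s ^ α * |f₁ s|) '' Ici 1))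
    (hf₂_norm : BddAbove ((fun s => s ^ α * |f₂ s|) '' Ici 1)) :
    normF α (fun s => T θ f₁ s - T θ f₂ s) ≤
      Real.Gamma (1 - α) * Real.Gamma (α + θ) / Real.Gamma θ *
        normF α (fun s => f₁ s - f₂ s) := by
  have hN := normF_nonneg α (fun s => f₁ s - f₂ s)
  have hbdd := bddAbove_weighted_sub hf₁_norm hf₂_norm
  refine csSup_le (nonempty_Ici.image _) ?_
  rintro _ ⟨s, hs, rfl⟩
  rcases (show (1 : ℝ) ≤ s from hs).eq_or_lt with rfl | hs
  · have hG1 : 0 < Real.Gamma (1 - α) := Gamma_pos_of_pos (by linarith [hα.2])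
    have hG2 : 0 < Real.Gamma (α + θ) := Gamma_pos_of_pos (by linarith [hα.1])
    have hG : 0 < Real.Gamma θ := Gamma_pos_of_pos hθ
    simp only [T, sub_self, zero_rpow hθ.ne', mul_zero, zero_mul, abs_zero]
    positivity
  have ha : 0 < s - 1 := by linarith
  have hdiff : T θ f₁ s - T θ f₂ s = θ * (s - 1) ^ θ *
      ∫ t in Ioi (1 : ℝ), (s + t - 1) ^ (-θ - 1) * (f₁ t - f₂ t) := by
    simp only [T, mul_sub]
    rw [integral_sub (integrableOn_kernel_mul hθ hs hf₁_meas hf₁_mem)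
      (integrableOn_kernel_mul hθ hs hf₂_meas hf₂_mem)]
    ring
  have hI : |∫ t in Ioi (1 : ℝ), (s + t - 1) ^ (-θ - 1) * (f₁ t - f₂ t)| ≤
      normF α (fun s => f₁ s - f₂ s) *
        ∫ t in Ioi (1 : ℝ), (s + t - 1) ^ (-θ - 1) * t ^ (-α) := by
    rw [← integral_const_mul, ← Real.norm_eq_abs]
    refine norm_integral_le_of_norm_le ((integrableOn_kernel hθ hα hs).const_mul _) ?_
    filter_upwards [ae_restrict_mem measurableSet_Ioi] with t ht
    have ht : (1 : ℝ) < t := ht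
    have h3 : 0 < s + t - 1 := by linarith
    rw [norm_mul, norm_of_nonneg (by positivity), Real.norm_eq_abs, mul_left_comm]
    exact mul_le_mul_of_nonneg_left (abs_le_normF_mul_rpow hbdd ht.le) (by positivity)
  have hs0 : 0 < s := by linarith
  have hk : 0 ≤ θ * (s - 1) ^ θ := by positivity
  simp only [hdiff, abs_mul (θ * (s - 1) ^ θ), abs_of_nonneg hk]
  calc
    _ ≤ s ^ α * (θ * (s - 1) ^ θ * (normF α (fun s => f₁ s - f₂ s) *
        ∫ t in Ioi (1 : ℝ), (s + t - 1) ^ (-θ - 1) * t ^ (-α))) := by gcongr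
    _ = s ^ α * (θ * (s - 1) ^ θ *
        ∫ t in Ioi (1 : ℝ), (s + t - 1) ^ (-θ - 1) * t ^ (-α)) *
          normF α (fun s => f₁ s - f₂ s) := by ring
    _ ≤ _ := mul_le_mul_of_nonneg_right (kernel_bound hθ hα hs) hN
end

section
/- Let θ > 1 and α ∈ (1−θ, 0). Then the constant function s ↦ 1 belongs to F_α, satisfies T(1) = 1, and is the unique fixed point of T in F_α: any measurable f : [1,∞) → [0,1] with sup_{s≥1} s^α |f(s)| < ∞ and T(f) = f equals 1 almost everywhere. -/
open MeasureTheory Real Set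

/-- Membership in the space `F_α`: `f` is measurable, takes values in `[0,1]` on
`[1,∞)`, and `sup_{s ≥ 1} s^α |f s| < ∞`. -/
def MemF (α : ℝ) (f : ℝ → ℝ) : Prop :=
  Measurable f ∧ (∀ s, 1 ≤ s → f s ∈ Icc (0 : ℝ) 1) ∧
    BddAbove ((fun s => s ^ α * |f s|) '' Ici 1)

theorem integrableOn_add_rpow_Ioi_one {θ s : ℝ} (hθ : 0 < θ) (hs : 1 ≤ s) :
    IntegrableOn (fun t : ℝ => (s + t - 1) ^ (-θ - 1)) (Ioi 1) := by
  have h := integrableOn_add_rpow_Ioi_of_lt (a := -θ - 1) (c := 1) (m := s - 1)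
    (by linarith) (by linarith)
  refine h.congr_fun (fun t _ => ?_) measurableSet_Ioi
  ring_nf

theorem integral_add_rpow_Ioi_one {θ s : ℝ} (hθ : 0 < θ) (hs : 1 ≤ s) :
    ∫ t in Ioi (1 : ℝ), (s + t - 1) ^ (-θ - 1) = s ^ (-θ) / θ := by
  have h := (measurePreserving_add_right volume (s - 1)).setIntegral_preimage_emb
    (measurableEmbedding_addRight (s - 1)) (fun t : ℝ => t ^ (-θ - 1)) (Ioi s)
  rw [preimage_add_const_Ioi, sub_sub_cancel,
    integral_Ioi_rpow_of_lt (by linarith) (by linarith), sub_add_cancel, neg_div_neg_eq] at h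
  rw [← h]
  refine setIntegral_congr_fun measurableSet_Ioi (fun t _ => ?_)
  ring_nf

theorem T_const_one {θ s : ℝ} (hθ : 0 < θ) (hs : 1 ≤ s) : T θ (fun _ => 1) s = 1 := by
  have hs0 : 0 < s := by linarith
  have h : 1 - 1 / s = (s - 1) / s := by field_simp
  simp only [T, mul_one]
  rw [integral_add_rpow_Ioi_one hθ hs, h, div_rpow (by linarith) hs0.le, rpow_neg hs0.le]
  field_simp
  ring

theorem memF_const_one {α : ℝ} (hα : α ≤ 0) : MemF α (fun _ => 1) := by
  refine ⟨measurable_const, fun _ _ => by simp, 1, ?_⟩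
  rintro _ ⟨s, hs, rfl⟩
  simpa using rpow_le_one_of_one_le_of_nonpos hs hα

/-- The defect `1 - f` of a fixed point solves the homogeneous equation. -/
theorem one_sub_eq_of_fixed {θ s : ℝ} {f : ℝ → ℝ} (hθ : 0 < θ) (hs : 1 ≤ s)
    (hf : Measurable f) (hf01 : ∀ t, 1 ≤ t → f t ∈ Icc (0 : ℝ) 1) (hfix : T θ f s = f s) :
    IntegrableOn (fun t => (s + t - 1) ^ (-θ - 1) * (1 - f t)) (Ioi 1) ∧
      1 - f s = θ * (s - 1) ^ θ *
        ∫ t in Ioi (1 : ℝ), (s + t - 1) ^ (-θ - 1) * (1 - f t) := by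
  have hk := integrableOn_add_rpow_Ioi_one hθ hs
  have hkf : IntegrableOn (fun t => (s + t - 1) ^ (-θ - 1) * f t) (Ioi 1) := by
    refine Integrable.mul_bdd (c := 1) hk hf.aestronglyMeasurable ?_
    filter_upwards [ae_restrict_mem measurableSet_Ioi] with t ht
    rw [norm_eq_abs, abs_of_nonneg (hf01 t (le_of_lt ht)).1]
    exact (hf01 t (le_of_lt ht)).2
  have heq : (fun t => (s + t - 1) ^ (-θ - 1) * (1 - f t)) =
      fun t => (s + t - 1) ^ (-θ - 1) - (s + t - 1) ^ (-θ - 1) * f t := by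
    ext t; ring
  rw [heq]
  refine ⟨hk.sub hkf, ?_⟩
  rw [integral_sub hk hkf]
  have h1 := T_const_one hθ hs
  simp only [T, mul_one] at h1 hfix
  linear_combination hfix - h1

/-- Tonelli's theorem for the homogeneous equation, integrated against `(s - 1) ^ (-θ)`. -/
theorem lintegral_weighted_defect {θ : ℝ} {f : ℝ → ℝ} (hθ : 0 < θ)
    (hf : Measurable f) (hf01 : ∀ t, 1 ≤ t → f t ∈ Icc (0 : ℝ) 1)
    (hfix : ∀ s, 1 ≤ s → T θ f s = f s) :
    ∫⁻ s in Ioi (1 : ℝ), ENNReal.ofReal ((s - 1) ^ (-θ) * (1 - f s)) =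
      ∫⁻ t in Ioi (1 : ℝ), ENNReal.ofReal (t ^ (-θ) * (1 - f t)) := by
  have hleft : ∀ s ∈ Ioi (1 : ℝ), ENNReal.ofReal ((s - 1) ^ (-θ) * (1 - f s)) =
      ∫⁻ t in Ioi (1 : ℝ), ENNReal.ofReal (θ * ((s + t - 1) ^ (-θ - 1) * (1 - f t))) := by
    intro s hs
    have hs' : 0 < s - 1 := sub_pos.2 hs
    obtain ⟨hint, heq⟩ := one_sub_eq_of_fixed hθ (le_of_lt hs) hf hf01 (hfix s (le_of_lt hs))
    rw [← ofReal_integral_eq_lintegral_ofReal (hint.const_mul θ), integral_const_mul, heq,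
      rpow_neg hs'.le]
    · congr 1
      have := (rpow_pos_of_pos hs' θ).ne'
      field_simp
    · filter_upwards [ae_restrict_mem measurableSet_Ioi] with t ht
      have ht' : (1 : ℝ) < t := ht
      have hpos : 0 ≤ s + t - 1 := by linarith
      exact mul_nonneg hθ.le (mul_nonneg (rpow_nonneg hpos _)
        (sub_nonneg.2 (hf01 t ht'.le).2))
  have hright : ∀ t ∈ Ioi (1 : ℝ),
      ∫⁻ s in Ioi (1 : ℝ), ENNReal.ofReal (θ * ((s + t - 1) ^ (-θ - 1) * (1 - f t))) =
        ENNReal.ofReal (t ^ (-θ) * (1 - f t)) := by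
    intro t ht
    have ht' : (1 : ℝ) < t := ht
    have hk := integrableOn_add_rpow_Ioi_one hθ ht'.le
    simp only [add_comm _ t]
    rw [← ofReal_integral_eq_lintegral_ofReal ((hk.mul_const (1 - f t)).const_mul θ),
      integral_const_mul, integral_mul_const, integral_add_rpow_Ioi_one hθ ht'.le]
    · congr 1
      field_simp
    · filter_upwards [ae_restrict_mem measurableSet_Ioi] with s hs
      have hs' : (1 : ℝ) < s := hs
      have hpos : 0 ≤ t + s - 1 := by linarith
      exact mul_nonneg hθ.le (mul_nonneg (rpow_nonneg hpos _)
        (sub_nonneg.2 (hf01 t ht'.le).2))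
  rw [setLIntegral_congr_fun measurableSet_Ioi hleft, lintegral_lintegral_swap,
    setLIntegral_congr_fun measurableSet_Ioi hright]
  refine Measurable.aemeasurable ?_
  unfold Function.uncurry
  fun_prop

/-- For `θ > 1` and `α ∈ (1−θ, 0)`, the constant function `1`
belongs to `F_α`, is a fixed point of `T`, and is the unique fixed point of `T`
in `F_α` up to almost-everywhere equality on `[1,∞)`. -/
theorem constant_one_unique_fixed_point (θ α : ℝ) (hθ : 1 < θ)
    (hα : α ∈ Ioo (1 - θ) (0 : ℝ)) :
    MemF α (fun _ => 1) ∧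
      (∀ s, 1 ≤ s → T θ (fun _ => 1) s = 1) ∧
      (∀ f : ℝ → ℝ, MemF α f → (∀ s, 1 ≤ s → T θ f s = f s) →
        ∀ᵐ s ∂(volume.restrict (Ici (1 : ℝ))), f s = 1) := by
  have hθ0 : 0 < θ := by linarith
  refine ⟨memF_const_one hα.2.le, fun s hs => T_const_one hθ0 hs, ?_⟩
  rintro f ⟨hf, hf01, -⟩ hfix
  rw [← restrict_Ioi_eq_restrict_Ici]
  have hfin : ∫⁻ t in Ioi (1 : ℝ), ENNReal.ofReal (t ^ (-θ) * (1 - f t)) ≠ ⊤ := by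
    have hint : IntegrableOn (fun t : ℝ => t ^ (-θ)) (Ioi 1) :=
      integrableOn_Ioi_rpow_of_lt (by linarith) one_pos
    refine ne_top_of_le_ne_top hint.lintegral_lt_top.ne ?_
    refine setLIntegral_mono (by fun_prop) fun t ht => ENNReal.ofReal_le_ofReal ?_
    have ht' : (1 : ℝ) < t := ht
    exact mul_le_of_le_one_right (rpow_nonneg (by linarith) _)
      (by linarith [(hf01 t ht'.le).1])
  have hweight : ∀ t : ℝ, 1 < t → t ^ (-θ) < (t - 1) ^ (-θ) := fun t ht =>
    rpow_lt_rpow_of_neg (by linarith) (by linarith) (by linarith)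
  have hae := ae_eq_of_ae_le_of_lintegral_le (μ := volume.restrict (Ioi (1 : ℝ)))
    (f := fun t => ENNReal.ofReal (t ^ (-θ) * (1 - f t)))
    (g := fun t => ENNReal.ofReal ((t - 1) ^ (-θ) * (1 - f t)))
    (by
      filter_upwards [ae_restrict_mem measurableSet_Ioi] with t ht
      exact ENNReal.ofReal_le_ofReal (mul_le_mul_of_nonneg_right (hweight t ht).le
        (sub_nonneg.2 (hf01 t (le_of_lt ht)).2)))
    hfin (by fun_prop) (lintegral_weighted_defect hθ0 hf hf01 hfix).le
  filter_upwards [hae, ae_restrict_mem measurableSet_Ioi] with t h ht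
  have ht' : (1 : ℝ) < t := ht
  have hg : 0 ≤ 1 - f t := sub_nonneg.2 (hf01 t ht'.le).2
  rw [ENNReal.ofReal_eq_ofReal_iff (mul_nonneg (rpow_nonneg (by linarith) _) hg)
    (mul_nonneg (rpow_nonneg (by linarith) _) hg)] at h
  rcases mul_eq_mul_right_iff.1 h with h | h
  · exact absurd h (hweight t ht').ne
  · linarith
end

section
/- Let θ ∈ (0,1). The function f_Bes(s) = (sin(πθ)/π) ∫_{s−1}^∞ t^{θ−1} (t+1)^{−1} dt takes values in [0,1] on [1,∞), satisfies f_Bes(1) = 1, is decreasing in s, and for every α ∈ (0, 1−θ) one has sup_{s≥1} s^α f_Bes(s) < ∞; i.e., f_Bes ∈ F_α for all α < 1−θ. -/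
open MeasureTheory Real Set

/-- The Bessel function `f_Bes(s) = (sin(πθ)/π) ∫_{s−1}^∞ t^{θ−1}(t+1)^{−1} dt`. -/
noncomputable def fBes (θ : ℝ) : ℝ → ℝ :=
  fun s => Real.sin (π * θ) / π * ∫ t in Ioi (s - 1), t ^ (θ - 1) * (t + 1)⁻¹

theorem lintegral_rpow_mul_exp_neg_mul_Ioi {a r : ℝ} (ha : 0 < a) (hr : 0 < r) :
    ∫⁻ t in Ioi (0 : ℝ), ENNReal.ofReal (t ^ (a - 1) * rexp (-(r * t))) =
      ENNReal.ofReal ((1 / r) ^ a * Real.Gamma a) := by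
  have key := Real.integral_rpow_mul_exp_neg_mul_Ioi ha hr
  have hpos : 0 < (1 / r) ^ a * Real.Gamma a :=
    mul_pos (by positivity) (Real.Gamma_pos_of_pos ha)
  rw [← key,
    ofReal_integral_eq_lintegral_ofReal (.of_integral_ne_zero (by rw [key]; exact hpos.ne'))]
  filter_upwards [ae_restrict_mem measurableSet_Ioi] with t ht
  have ht : 0 < t := ht
  positivity

theorem lintegral_rpow_mul_inv_add_one_Ioi {θ : ℝ} (hθ : θ ∈ Ioo (0 : ℝ) 1) :
    ∫⁻ t in Ioi (0 : ℝ), ENNReal.ofReal (t ^ (θ - 1) * (t + 1)⁻¹) =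
      ENNReal.ofReal (π / Real.sin (π * θ)) := by
  obtain ⟨h0, h1⟩ := hθ
  calc
    _ = ∫⁻ t in Ioi (0 : ℝ), ∫⁻ u in Ioi (0 : ℝ),
        ENNReal.ofReal (t ^ (θ - 1) * rexp (-((t + 1) * u))) := by
      refine setLIntegral_congr_fun measurableSet_Ioi fun t ht ↦ ?_
      have ht : 0 < t := ht
      have key := lintegral_rpow_mul_exp_neg_mul_Ioi one_pos (by positivity : 0 < t + 1)
      simp only [sub_self, rpow_zero, one_mul, rpow_one, Real.Gamma_one, mul_one, one_div] at key
      have hpow : 0 ≤ t ^ (θ - 1) := by positivity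
      simp only [ENNReal.ofReal_mul hpow]
      rw [lintegral_const_mul _ (by fun_prop), key]
    _ = ∫⁻ u in Ioi (0 : ℝ), ∫⁻ t in Ioi (0 : ℝ),
        ENNReal.ofReal (t ^ (θ - 1) * rexp (-((t + 1) * u))) :=
      lintegral_lintegral_swap (by fun_prop)
    _ = ∫⁻ u in Ioi (0 : ℝ),
        ENNReal.ofReal (Real.Gamma θ) * ENNReal.ofReal (u ^ ((1 - θ) - 1) * rexp (-(1 * u))) := by
      refine setLIntegral_congr_fun measurableSet_Ioi fun u hu ↦ ?_
      have hu : 0 < u := hu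
      have hsplit (t : ℝ) : ENNReal.ofReal (t ^ (θ - 1) * rexp (-((t + 1) * u))) =
          ENNReal.ofReal (rexp (-u)) * ENNReal.ofReal (t ^ (θ - 1) * rexp (-(u * t))) := by
        rw [← ENNReal.ofReal_mul (exp_pos _).le, mul_left_comm, ← Real.exp_add]
        ring_nf
      simp only [hsplit]
      rw [lintegral_const_mul _ (by fun_prop), lintegral_rpow_mul_exp_neg_mul_Ioi h0 hu,
        ← ENNReal.ofReal_mul (exp_pos _).le, ← ENNReal.ofReal_mul (Real.Gamma_pos_of_pos h0).le,
        one_div, Real.inv_rpow hu.le, ← Real.rpow_neg hu.le, one_mul,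
        show 1 - θ - 1 = -θ by ring]
      ring_nf
    _ = _ := by
      rw [lintegral_const_mul _ (by fun_prop),
        lintegral_rpow_mul_exp_neg_mul_Ioi (sub_pos.2 h1) one_pos,
        ← ENNReal.ofReal_mul (Real.Gamma_pos_of_pos h0).le, div_one, one_rpow, one_mul,
        Real.Gamma_mul_Gamma_one_sub]

theorem sin_pi_mul_pos {θ : ℝ} (hθ : θ ∈ Ioo (0 : ℝ) 1) : 0 < Real.sin (π * θ) :=
  Real.sin_pos_of_pos_of_lt_pi (mul_pos pi_pos hθ.1) (mul_lt_of_lt_one_right pi_pos hθ.2)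

theorem rpow_mul_inv_add_one_nonneg (θ : ℝ) {t : ℝ} (ht : 0 ≤ t) :
    0 ≤ t ^ (θ - 1) * (t + 1)⁻¹ := by
  positivity

theorem integral_rpow_mul_inv_add_one_Ioi {θ : ℝ} (hθ : θ ∈ Ioo (0 : ℝ) 1) :
    ∫ t in Ioi (0 : ℝ), t ^ (θ - 1) * (t + 1)⁻¹ = π / Real.sin (π * θ) := by
  rw [integral_eq_lintegral_of_nonneg_ae, lintegral_rpow_mul_inv_add_one_Ioi hθ,
    ENNReal.toReal_ofReal (div_pos pi_pos (sin_pi_mul_pos hθ)).le]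
  · filter_upwards [ae_restrict_mem measurableSet_Ioi] with t ht
    exact rpow_mul_inv_add_one_nonneg θ (le_of_lt ht)
  · exact Measurable.aestronglyMeasurable (by fun_prop)

theorem integrableOn_rpow_mul_inv_add_one_Ioi {θ : ℝ} (hθ : θ ∈ Ioo (0 : ℝ) 1) :
    IntegrableOn (fun t : ℝ ↦ t ^ (θ - 1) * (t + 1)⁻¹) (Ioi 0) :=
  .of_integral_ne_zero <| by
    rw [integral_rpow_mul_inv_add_one_Ioi hθ]
    exact (div_pos pi_pos (sin_pi_mul_pos hθ)).ne'

theorem fBes_one {θ : ℝ} (hθ : θ ∈ Ioo (0 : ℝ) 1) : fBes θ 1 = 1 := by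
  have := (sin_pi_mul_pos hθ).ne'
  rw [fBes, sub_self, integral_rpow_mul_inv_add_one_Ioi hθ]
  field_simp

theorem fBes_nonneg {θ : ℝ} (hθ : θ ∈ Ioo (0 : ℝ) 1) {s : ℝ} (hs : 1 ≤ s) : 0 ≤ fBes θ s :=
  mul_nonneg (div_pos (sin_pi_mul_pos hθ) pi_pos).le <|
    setIntegral_nonneg measurableSet_Ioi fun _ ht ↦
      rpow_mul_inv_add_one_nonneg θ ((sub_nonneg.2 hs).trans (le_of_lt ht))

theorem fBes_antitoneOn {θ : ℝ} (hθ : θ ∈ Ioo (0 : ℝ) 1) : AntitoneOn (fBes θ) (Ici 1) := by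
  intro s hs s' _ hss'
  have hs0 : 0 ≤ s - 1 := sub_nonneg.2 hs
  refine mul_le_mul_of_nonneg_left ?_ (div_pos (sin_pi_mul_pos hθ) pi_pos).le
  refine setIntegral_mono_set
    ((integrableOn_rpow_mul_inv_add_one_Ioi hθ).mono_set (Ioi_subset_Ioi hs0)) ?_
    (Ioi_subset_Ioi (sub_le_sub_right hss' 1)).eventuallyLE
  filter_upwards [ae_restrict_mem measurableSet_Ioi] with t ht
  exact rpow_mul_inv_add_one_nonneg θ (hs0.trans (le_of_lt ht))

/-- The bound follows from `s ^ α ≤ (t + 1) ^ α ≤ t ^ α + 1` on the domain of integration. -/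
theorem rpow_mul_fBes_le {θ α : ℝ} (hθ : θ ∈ Ioo (0 : ℝ) 1) (hα : α ∈ Ioo (0 : ℝ) (1 - θ))
    {s : ℝ} (hs : 1 ≤ s) :
    s ^ α * fBes θ s ≤
      Real.sin (π * θ) / π * (π / Real.sin (π * (θ + α)) + π / Real.sin (π * θ)) := by
  have hθα : θ + α ∈ Ioo (0 : ℝ) 1 := ⟨add_pos hθ.1 hα.1, by linarith [hα.2]⟩
  have hs0 : 0 ≤ s - 1 := sub_nonneg.2 hs
  have hint := integrableOn_rpow_mul_inv_add_one_Ioi hθ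
  have hint' := integrableOn_rpow_mul_inv_add_one_Ioi hθα
  have hsub : Ioi (s - 1) ⊆ Ioi 0 := Ioi_subset_Ioi hs0
  rw [fBes, mul_left_comm, ← integral_const_mul]
  refine mul_le_mul_of_nonneg_left ?_ (div_pos (sin_pi_mul_pos hθ) pi_pos).le
  calc
    _ ≤ ∫ t in Ioi (s - 1), (t ^ (θ + α - 1) * (t + 1)⁻¹ + t ^ (θ - 1) * (t + 1)⁻¹) := by
      refine setIntegral_mono_on ((hint.mono_set hsub).const_mul _)
        ((hint'.add hint).mono_set hsub) measurableSet_Ioi fun t ht ↦ ?_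
      have ht0 : 0 < t := hsub ht
      have hle : s ^ α ≤ t ^ α + 1 := by
        calc s ^ α ≤ (t + 1) ^ α :=
              Real.rpow_le_rpow (by linarith) (by linarith [mem_Ioi.1 ht]) hα.1.le
          _ ≤ t ^ α + 1 := by
              simpa using Real.rpow_add_le_add_rpow ht0.le zero_le_one hα.1.le
                (by linarith [hα.2, hθ.1])
      calc _ ≤ (t ^ α + 1) * (t ^ (θ - 1) * (t + 1)⁻¹) :=
            mul_le_mul_of_nonneg_right hle (rpow_mul_inv_add_one_nonneg θ ht0.le)
        _ = _ := by
            rw [show θ + α - 1 = α + (θ - 1) by ring, Real.rpow_add ht0]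
            ring
    _ ≤ ∫ t in Ioi 0, (t ^ (θ + α - 1) * (t + 1)⁻¹ + t ^ (θ - 1) * (t + 1)⁻¹) := by
      refine setIntegral_mono_set (hint'.add hint) ?_ hsub.eventuallyLE
      filter_upwards [ae_restrict_mem measurableSet_Ioi] with t ht
      exact add_nonneg (rpow_mul_inv_add_one_nonneg _ (le_of_lt ht))
        (rpow_mul_inv_add_one_nonneg _ (le_of_lt ht))
    _ = _ := by
      rw [integral_add hint' hint, integral_rpow_mul_inv_add_one_Ioi hθ,
        integral_rpow_mul_inv_add_one_Ioi hθα]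

/-- For `θ ∈ (0,1)`: `f_Bes` takes values in `[0,1]` on `[1,∞)`,
`f_Bes(1) = 1`, `f_Bes` is decreasing on `[1,∞)`, and for every `α ∈ (0, 1−θ)` one
has `sup_{s ≥ 1} s^α f_Bes(s) < ∞`, i.e. `f_Bes ∈ F_α` for all `α < 1 − θ`. -/
theorem fBes_properties (θ : ℝ) (hθ : θ ∈ Ioo (0 : ℝ) 1) :
    (∀ s, 1 ≤ s → fBes θ s ∈ Icc (0 : ℝ) 1) ∧
      fBes θ 1 = 1 ∧
      AntitoneOn (fBes θ) (Ici 1) ∧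
      ∀ α ∈ Ioo (0 : ℝ) (1 - θ),
        BddAbove ((fun s => s ^ α * fBes θ s) '' Ici 1) := by
  refine ⟨fun s hs ↦ ⟨fBes_nonneg hθ hs, ?_⟩, fBes_one hθ, fBes_antitoneOn hθ,
    fun α hα ↦ ⟨Real.sin (π * θ) / π * (π / Real.sin (π * (θ + α)) + π / Real.sin (π * θ)), ?_⟩⟩
  · exact (fBes_antitoneOn hθ self_mem_Ici hs hs).trans_eq (fBes_one hθ)
  · rintro _ ⟨s, hs, rfl⟩
    exact rpow_mul_fBes_le hθ hα hs
end
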